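/- arXiv:0807.5111 — 2 statements merged into one kernel-verified Lean document; each statement's English description precedes it below -/
import Mathlib

section
/- For every ε > 0, the probability that the Erdős–Rényi random graph G(n, 1/2) contains a vertex subset S with |S| = ⌊2 log₂ n⌋ whose induced subgraph has edge density at least 0.951 − ε tends to 1 as n → ∞. -/
open MeasureTheory Filter

/-- The Erdős–Rényi `G(n, 1/2)` measure: the uniform probability measure on
edge-indicator functions `Sym2 (Fin n) → Bool`. -/
noncomputable def gnHalf (n : ℕ) : Measure (Sym2 (Fin n) → Bool) :=
  (PMF.uniformOfFintype (Sym2 (Fin n) → Bool)).toMeasure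

open scoped Classical in
/-- Number of edges of the graph `g` with both endpoints in `S`. -/
noncomputable def edgeCount (n : ℕ) (g : Sym2 (Fin n) → Bool) (S : Finset (Fin n)) : ℕ :=
  (Finset.univ.filter fun e : Sym2 (Fin n) =>
    g e = true ∧ ¬ e.IsDiag ∧ ∀ v ∈ e, v ∈ S).card

/-- Edge density of the subgraph induced by `S`. -/
noncomputable def density (n : ℕ) (g : Sym2 (Fin n) → Bool) (S : Finset (Fin n)) : ℝ :=
  (edgeCount n g S : ℝ) / (S.card.choose 2 : ℝ)

/-- Binary entropy function (base-2 logarithms). -/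
noncomputable def binEnt (δ : ℝ) : ℝ :=
  -δ * Real.logb 2 δ - (1 - δ) * Real.logb 2 (1 - δ)

/-- Inverse of the binary entropy function restricted to `[0, 1/2]`. -/
noncomputable def binEntInv (y : ℝ) : ℝ :=
  sSup {x : ℝ | x ∈ Set.Icc (0 : ℝ) (1/2) ∧ binEnt x ≤ y}


/-- Potential edges inside `T`. -/
def cliqueEdges {n : ℕ} (T : Finset (Fin n)) : Finset (Sym2 (Fin n)) :=
  T.offDiag.image Sym2.mk.uncurry

lemma mem_cliqueEdges {n : ℕ} (T : Finset (Fin n)) (e : Sym2 (Fin n)) :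
    e ∈ cliqueEdges T ↔ ¬ e.IsDiag ∧ ∀ v ∈ e, v ∈ T := by
  induction e using Sym2.ind with
  | _ a b =>
    simp only [cliqueEdges, Finset.mem_image, Finset.mem_offDiag, Prod.exists,
      Function.uncurry_apply_pair, Sym2.eq_iff, Sym2.mk_isDiag_iff, Sym2.mem_iff]
    constructor
    · rintro ⟨x, y, ⟨hx, hy, hxy⟩, h⟩
      rcases h with ⟨rfl, rfl⟩ | ⟨rfl, rfl⟩
      · exact ⟨hxy, by rintro v (rfl | rfl) <;> assumption⟩
      · exact ⟨fun h => hxy h.symm, by rintro v (rfl | rfl) <;> assumption⟩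
    · rintro ⟨h1, h2⟩
      exact ⟨a, b, ⟨h2 a (Or.inl rfl), h2 b (Or.inr rfl), h1⟩, Or.inl ⟨rfl, rfl⟩⟩

lemma card_cliqueEdges {n : ℕ} (T : Finset (Fin n)) :
    (cliqueEdges T).card = T.card.choose 2 := Sym2.card_image_offDiag T

lemma cliqueEdges_inter {n : ℕ} (S T : Finset (Fin n)) :
    cliqueEdges S ∩ cliqueEdges T = cliqueEdges (S ∩ T) := by
  ext e
  simp only [Finset.mem_inter, mem_cliqueEdges]
  constructor
  · rintro ⟨⟨h, h1⟩, _, h2⟩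
    exact ⟨h, fun v hv => ⟨h1 v hv, h2 v hv⟩⟩
  · rintro ⟨h, h1⟩
    exact ⟨⟨h, fun v hv => (h1 v hv).1⟩, h, fun v hv => (h1 v hv).2⟩

lemma card_contains {α : Type*} [Fintype α] [DecidableEq α] (A : Finset α) :
    ((Finset.univ.filter fun g : α → Bool => ∀ e ∈ A, g e = true).card : ℝ) =
      (Fintype.card (α → Bool) : ℝ) / 2 ^ A.card := by
  have h : (Finset.univ.filter fun g : α → Bool => ∀ e ∈ A, g e = true) =
      Fintype.piFinset (fun e => if e ∈ A then {true} else Finset.univ) := by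
    ext g
    simp only [Finset.mem_filter, Finset.mem_univ, true_and, Fintype.mem_piFinset]
    refine forall_congr' fun e => ?_
    by_cases he : e ∈ A <;> simp [he]
  have h2 : (Fintype.piFinset (fun e => if e ∈ A then ({true} : Finset Bool)
      else Finset.univ)).card * 2 ^ A.card = 2 ^ Fintype.card α := by
    rw [Fintype.card_piFinset]
    have : ∀ e : α, (if e ∈ A then ({true} : Finset Bool) else Finset.univ).card =
        if e ∈ A then 1 else 2 := by
      intro e; by_cases he : e ∈ A <;> simp [he]
    simp_rw [this]
    have h3 : (2 : ℕ) ^ A.card = ∏ e : α, if e ∈ A then 2 else 1 := by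
      rw [Finset.prod_ite]; simp
    rw [h3, ← Finset.prod_mul_distrib, ← Finset.card_univ, ← Finset.prod_const]
    refine Finset.prod_congr rfl fun e _ => ?_
    by_cases he : e ∈ A <;> simp [he]
  rw [h, eq_div_iff (by positivity)]
  have h4 : Fintype.card (α → Bool) = 2 ^ Fintype.card α := by simp
  rw [h4]
  exact_mod_cast h2

lemma descFactorial_ratio {m n : ℕ} (h : m ≤ n) (l : ℕ) :
    m.descFactorial l * n ^ l ≤ n.descFactorial l * m ^ l := by
  induction l with
  | zero => simp
  | succ l ih =>
    rw [Nat.descFactorial_succ, Nat.descFactorial_succ, pow_succ, pow_succ]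
    have h1 : (m - l) * n ≤ (n - l) * m := by
      rw [Nat.sub_mul, Nat.sub_mul, mul_comm m n]
      exact Nat.sub_le_sub_left (Nat.mul_le_mul_left l h) _
    calc _ = ((m - l) * n) * (m.descFactorial l * n ^ l) := by ring
      _ ≤ ((n - l) * m) * (n.descFactorial l * m ^ l) := Nat.mul_le_mul h1 ih
      _ = _ := by ring

lemma choose_ratio {m n l : ℕ} (h : m ≤ n) (hl : l ≤ m) (hn : 0 < n) :
    ((n - l).choose (m - l) : ℝ) ≤ n.choose m * ((m : ℝ) / n) ^ l := by
  have h1 := Nat.choose_mul (n := n) hl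
  have h2 : m.choose l * n ^ l ≤ n.choose l * m ^ l := by
    have := descFactorial_ratio h l
    rw [Nat.descFactorial_eq_factorial_mul_choose, Nat.descFactorial_eq_factorial_mul_choose,
      mul_assoc, mul_assoc] at this
    exact Nat.le_of_mul_le_mul_left this (Nat.factorial_pos l)
  have h3 : 0 < n.choose l := Nat.choose_pos (hl.trans h)
  have h4 : (n - l).choose (m - l) * n ^ l ≤ n.choose m * m ^ l := by
    refine Nat.le_of_mul_le_mul_left ?_ h3
    calc _ = n.choose m * m.choose l * n ^ l := by rw [h1]; ring
      _ = n.choose m * (m.choose l * n ^ l) := by ring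
      _ ≤ n.choose m * (n.choose l * m ^ l) := Nat.mul_le_mul_left _ h2
      _ = _ := by ring
  rw [div_pow, mul_div_assoc', le_div_iff₀ (by positivity)]
  exact_mod_cast h4

lemma pow_choose_two_le {l m : ℕ} (h : l ≤ m) :
    (2 : ℝ) ^ (l.choose 2) ≤ (√2 ^ m) ^ l := by
  have h1 : (2 : ℝ) ^ (l.choose 2) = √2 ^ (2 * l.choose 2) := by
    rw [pow_mul, Real.sq_sqrt (by norm_num)]
  rw [h1, ← pow_mul]
  refine pow_le_pow_right₀ (Real.one_le_sqrt.mpr (by norm_num)) ?_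
  rw [Nat.choose_two_right]
  calc 2 * (l * (l - 1) / 2) ≤ l * (l - 1) := Nat.mul_div_le _ _
    _ ≤ l * m := Nat.mul_le_mul_left _ (by omega)
    _ = _ := mul_comm _ _

lemma overlap_sum {n m : ℕ} (hm : m ≤ n) (hn : 0 < n) (S : Finset (Fin n)) (hS : S.card = m) :
    ∑ T ∈ Finset.powersetCard m (Finset.univ : Finset (Fin n)),
      (2 : ℝ) ^ ((S ∩ T).card.choose 2) ≤ n.choose m * (1 + √2 ^ m * m / n) ^ m := by
  calc ∑ T ∈ Finset.powersetCard m (Finset.univ : Finset (Fin n)),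
      (2 : ℝ) ^ ((S ∩ T).card.choose 2)
      ≤ ∑ T ∈ Finset.powersetCard m (Finset.univ : Finset (Fin n)),
        ∑ A ∈ S.powerset, if A ⊆ T then (√2 ^ m) ^ A.card else 0 := by
        refine Finset.sum_le_sum fun T _ => ?_
        refine le_trans ?_ (Finset.single_le_sum (f := fun A => if A ⊆ T then (√2 ^ m) ^ A.card
          else 0) (fun A _ => ?_) (Finset.mem_powerset.mpr (Finset.inter_subset_left (s₂ := T))))
        · simp only [Finset.inter_subset_right, if_true]
          exact pow_choose_two_le (hS ▸ Finset.card_le_card Finset.inter_subset_left)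
        · split_ifs <;> positivity
    _ = ∑ A ∈ S.powerset, ((n - A.card).choose (m - A.card) : ℝ) * (√2 ^ m) ^ A.card := by
        rw [Finset.sum_comm]
        refine Finset.sum_congr rfl fun A hA => ?_
        have hA' : A.card ≤ m := hS ▸ Finset.card_le_card (Finset.mem_powerset.mp hA)
        rw [← Finset.sum_filter, Finset.sum_const, nsmul_eq_mul,
          Finset.card_filter_powersetCard_subset A _ m (Finset.subset_univ _) hA']
        simp
    _ ≤ ∑ A ∈ S.powerset, n.choose m * ((√2 ^ m * m / n) ^ A.card * 1 ^ (S.card - A.card)) := by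
        refine Finset.sum_le_sum fun A hA => ?_
        have hA' : A.card ≤ m := hS ▸ Finset.card_le_card (Finset.mem_powerset.mp hA)
        calc _ ≤ (n.choose m * ((m : ℝ) / n) ^ A.card) * (√2 ^ m) ^ A.card := by
              gcongr
              exact choose_ratio hm hA' hn
          _ = _ := by rw [one_pow, mul_one, mul_assoc, ← mul_pow]; congr 2; ring
    _ = _ := by
        rw [← Finset.mul_sum, Finset.sum_pow_mul_eq_add_pow, hS, add_comm]

lemma good_bound {n m : ℕ} (hm : m ≤ n) (hn : 0 < n) :
    (Fintype.card (Sym2 (Fin n) → Bool) : ℝ) ≤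
      ((Finset.univ.filter fun g : Sym2 (Fin n) → Bool =>
        ∃ T : Finset (Fin n), T.card = m ∧ ∀ e ∈ cliqueEdges T, g e = true).card : ℝ) *
        (1 + √2 ^ m * m / n) ^ m := by
  set R : ℝ := (1 + √2 ^ m * m / n) ^ m with hR
  set N : ℝ := (Fintype.card (Sym2 (Fin n) → Bool) : ℝ) with hN
  set P := Finset.powersetCard m (Finset.univ : Finset (Fin n)) with hP
  set G := (Finset.univ.filter fun g : Sym2 (Fin n) → Bool =>
        ∃ T : Finset (Fin n), T.card = m ∧ ∀ e ∈ cliqueEdges T, g e = true) with hG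
  have hPm : ∀ T ∈ P, T.card = m := fun T hT => (Finset.mem_powersetCard.mp hT).2
  have hNpos : 0 < N := by rw [hN]; exact_mod_cast Fintype.card_pos
  have hM : (0 : ℝ) < n.choose m := by exact_mod_cast Nat.choose_pos hm
  let I : Finset (Fin n) → (Sym2 (Fin n) → Bool) → ℝ := fun T g =>
    if ∀ e ∈ cliqueEdges T, g e = true then 1 else 0
  let X : (Sym2 (Fin n) → Bool) → ℝ := fun g => ∑ T ∈ P, I T g
  have hX0 : ∀ g, g ∉ G → X g = 0 := by
    intro g hg
    refine Finset.sum_eq_zero fun T hT => ?_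
    have : ¬ ∀ e ∈ cliqueEdges T, g e = true := fun h =>
      hg (Finset.mem_filter.mpr ⟨Finset.mem_univ _, T, hPm T hT, h⟩)
    simp only [I, if_neg this]
  have h1 : ∑ g, X g = n.choose m * (N / 2 ^ (m.choose 2)) := by
    simp only [X]
    rw [Finset.sum_comm]
    have : ∀ T ∈ P, ∑ g, I T g = N / 2 ^ (m.choose 2) := by
      intro T hT
      simp only [I]
      rw [Finset.sum_boole, card_contains, card_cliqueEdges, hPm T hT]
    rw [Finset.sum_congr rfl this, Finset.sum_const, nsmul_eq_mul, hP, Finset.card_powersetCard]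
    simp
  have h2 : ∑ g, X g ^ 2 ≤ N / (2 ^ (m.choose 2)) ^ 2 * (n.choose m * (n.choose m * R)) := by
    have e1 : ∑ g, X g ^ 2 = ∑ S ∈ P, ∑ T ∈ P, ∑ g, I S g * I T g := by
      simp only [X, sq, Finset.sum_mul_sum]
      rw [Finset.sum_comm]
      refine Finset.sum_congr rfl fun S _ => ?_
      rw [Finset.sum_comm]
    have e2 : ∀ S ∈ P, ∀ T ∈ P, ∑ g, I S g * I T g =
        N / (2 ^ (m.choose 2)) ^ 2 * 2 ^ ((S ∩ T).card.choose 2) := by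
      intro S hS T hT
      have : ∀ g, I S g * I T g =
          if ∀ e ∈ cliqueEdges S ∪ cliqueEdges T, g e = true then 1 else 0 := by
        intro g
        simp only [I, Finset.mem_union, or_imp, forall_and]
        split_ifs <;> simp_all
      simp only [this]
      rw [Finset.sum_boole, card_contains]
      have hc := Finset.card_union_add_card_inter (cliqueEdges S) (cliqueEdges T)
      rw [cliqueEdges_inter, card_cliqueEdges, card_cliqueEdges, card_cliqueEdges, hPm S hS,
        hPm T hT] at hc
      rw [div_mul_eq_mul_div, div_eq_div_iff (by positivity) (by positivity), mul_assoc,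
        ← pow_add, ← pow_mul, mul_two, add_comm ((S ∩ T).card.choose 2), hc]
    rw [e1]
    calc _ = ∑ S ∈ P, N / (2 ^ (m.choose 2)) ^ 2 * ∑ T ∈ P, (2 : ℝ) ^ ((S ∩ T).card.choose 2) := by
          refine Finset.sum_congr rfl fun S hS => ?_
          rw [Finset.mul_sum]
          exact Finset.sum_congr rfl fun T hT => e2 S hS T hT
      _ ≤ ∑ S ∈ P, N / (2 ^ (m.choose 2)) ^ 2 * (n.choose m * R) := by
          refine Finset.sum_le_sum fun S hS => ?_
          gcongr
          exact overlap_sum hm hn S (hPm S hS)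
      _ = _ := by
          rw [Finset.sum_const, nsmul_eq_mul, hP, Finset.card_powersetCard]
          simp only [Finset.card_univ, Fintype.card_fin]
          ring
  have h3 : (∑ g, X g) ^ 2 ≤ (G.card : ℝ) * ∑ g, X g ^ 2 := by
    have a1 : ∑ g, X g = ∑ g ∈ G, X g :=
      (Finset.sum_subset (Finset.subset_univ G) fun g _ hg => hX0 g hg).symm
    rw [a1]
    refine sq_sum_le_card_mul_sum_sq.trans ?_
    gcongr
    exact Finset.subset_univ G
  rw [h1] at h3
  have h4 := h3.trans (mul_le_mul_of_nonneg_left h2 (Nat.cast_nonneg _))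
  have hc : (0 : ℝ) < n.choose m ^ 2 * N / (2 ^ (m.choose 2)) ^ 2 := by positivity
  refine le_of_mul_le_mul_left ?_ hc
  calc _ = (n.choose m * (N / 2 ^ (m.choose 2))) ^ 2 := by field_simp
    _ ≤ _ := h4
    _ = _ := by ring

lemma density_of_clique {n m k : ℕ} (hmk : m ≤ k) (hkn : k ≤ n) (g : Sym2 (Fin n) → Bool)
    (h : ∃ T : Finset (Fin n), T.card = m ∧ ∀ e ∈ cliqueEdges T, g e = true) :
    ∃ S : Finset (Fin n), S.card = k ∧ (m.choose 2 : ℝ) / k.choose 2 ≤ density n g S := by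
  obtain ⟨T, hT, hg⟩ := h
  obtain ⟨S, hTS, hS⟩ := Finset.exists_superset_card_eq (s := T) (n := k) (hT ▸ hmk) (by simpa using hkn)
  refine ⟨S, hS, ?_⟩
  unfold density
  rw [hS]
  gcongr
  rw [← hT, ← card_cliqueEdges, edgeCount]
  refine Finset.card_le_card fun e he => ?_
  have := (mem_cliqueEdges T e).mp he
  exact Finset.mem_filter.mpr ⟨Finset.mem_univ _, hg e he, this.1, fun v hv => hTS (this.2 v hv)⟩

lemma gnHalf_lower {n m k : ℕ} (hmk : m ≤ k) (hkn : k ≤ n) (hn : 0 < n) (c : ℝ)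
    (hc : c ≤ (m.choose 2 : ℝ) / k.choose 2) :
    ENNReal.ofReal (1 - √2 ^ m * m / n * m) ≤ gnHalf n {g | ∃ S : Finset (Fin n),
          S.card = k ∧ c ≤ density n g S} := by
  classical
  set G := (Finset.univ.filter fun g : Sym2 (Fin n) → Bool =>
        ∃ T : Finset (Fin n), T.card = m ∧ ∀ e ∈ cliqueEdges T, g e = true) with hG
  have hsub : (G : Set (Sym2 (Fin n) → Bool)) ⊆ {g | ∃ S : Finset (Fin n),
          S.card = k ∧ c ≤ density n g S} := by
    intro g hg
    have hg' := (Finset.mem_filter.mp (Finset.mem_coe.mp hg)).2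
    obtain ⟨S, hS, hd⟩ := density_of_clique hmk hkn g hg'
    exact ⟨S, hS, hc.trans hd⟩
  refine le_trans ?_ (measure_mono hsub)
  have hb := good_bound (hmk.trans hkn) hn
  rw [← hG] at hb
  rw [gnHalf, PMF.toMeasure_uniformOfFintype_apply _ (Set.toFinite _).measurableSet]
  have hNpos : (0 : ℝ) < (Fintype.card (Sym2 (Fin n) → Bool) : ℝ) := by
    exact_mod_cast Fintype.card_pos
  set x : ℝ := √2 ^ m * m / n with hx
  have hx0 : 0 ≤ x := by positivity
  have hR : (1 + x) ^ m ≤ Real.exp (x * m) := by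
    rw [mul_comm, Real.exp_nat_mul]
    gcongr
    linarith [Real.add_one_le_exp x]
  have hfin : 1 - x * m ≤ (G.card : ℝ) / (Fintype.card (Sym2 (Fin n) → Bool) : ℝ) := by
    rw [le_div_iff₀ hNpos]
    have e1 : 1 - x * m ≤ Real.exp (-(x * m)) := by linarith [Real.add_one_le_exp (-(x * m))]
    calc _ ≤ Real.exp (-(x * m)) * (Fintype.card (Sym2 (Fin n) → Bool) : ℝ) := by gcongr
      _ ≤ Real.exp (-(x * m)) * (G.card * Real.exp (x * m)) := by
          gcongr
          exact hb.trans (by gcongr)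
      _ = G.card := by
          rw [mul_left_comm, ← Real.exp_add]; simp
  refine (ENNReal.ofReal_le_ofReal hfin).trans ?_
  rw [ENNReal.ofReal_div_of_pos hNpos, ENNReal.ofReal_natCast, ENNReal.ofReal_natCast]
  simp

lemma err_tendsto : Tendsto (fun n : ℕ =>
    √2 ^ ⌊(0.98 : ℝ) * (⌊2 * Real.logb 2 n⌋₊ : ℝ)⌋₊ * (⌊(0.98 : ℝ) * (⌊2 * Real.logb 2 n⌋₊ : ℝ)⌋₊ : ℝ) / n
      * (⌊(0.98 : ℝ) * (⌊2 * Real.logb 2 n⌋₊ : ℝ)⌋₊ : ℝ)) atTop (nhds 0) := by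
  have h1 : Tendsto (fun n : ℕ => (4 / Real.log 2 ^ 2) * (Real.log n ^ (2 : ℝ) / (n : ℝ) ^ (0.02 : ℝ)))
      atTop (nhds 0) := by
    have := ((isLittleO_log_rpow_rpow_atTop (s := 0.02) 2 (by norm_num)).tendsto_div_nhds_zero).comp
      (tendsto_natCast_atTop_atTop (R := ℝ))
    simpa using this.const_mul (4 / Real.log 2 ^ 2)
  refine squeeze_zero' (Eventually.of_forall fun n => by positivity) ?_ h1
  filter_upwards [eventually_ge_atTop 2] with n hn
  have hn0 : (0 : ℝ) < n := by positivity
  have hn1 : (1 : ℝ) ≤ n := by exact_mod_cast (by omega : 1 ≤ n)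
  have hL : 0 ≤ Real.logb 2 n := Real.logb_nonneg (by norm_num) hn1
  set k := ⌊2 * Real.logb 2 n⌋₊
  set m := ⌊(0.98 : ℝ) * (k : ℝ)⌋₊
  have hk : (k : ℝ) ≤ 2 * Real.logb 2 n := Nat.floor_le (by positivity)
  have hm : (m : ℝ) ≤ 0.98 * k := Nat.floor_le (by positivity)
  have hm2 : (m : ℝ) ≤ 2 * Real.logb 2 n := by
    have : (0 : ℝ) ≤ k := by positivity
    linarith
  have hs : √2 ^ m ≤ (n : ℝ) ^ (0.98 : ℝ) := by
    have e1 : √2 ^ m = (2 : ℝ) ^ ((m : ℝ) / 2) := by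
      rw [Real.sqrt_eq_rpow, ← Real.rpow_natCast, ← Real.rpow_mul (by norm_num)]
      congr 1; ring
    have e2 : (n : ℝ) ^ (0.98 : ℝ) = (2 : ℝ) ^ (Real.logb 2 n * 0.98) := by
      rw [Real.rpow_mul (by norm_num), Real.rpow_logb (by norm_num) (by norm_num) hn0]
    rw [e1, e2]
    apply Real.rpow_le_rpow_of_exponent_le (by norm_num)
    linarith
  have hnn : (n : ℝ) = (n : ℝ) ^ (0.98 : ℝ) * (n : ℝ) ^ (0.02 : ℝ) := by
    rw [← Real.rpow_add hn0]; norm_num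
  calc √2 ^ m * m / n * m = √2 ^ m * (m * m) / n := by ring
    _ ≤ (n : ℝ) ^ (0.98 : ℝ) * ((2 * Real.logb 2 n) * (2 * Real.logb 2 n)) / n := by gcongr
    _ = (n : ℝ) ^ (0.98 : ℝ) * ((2 * Real.logb 2 n) * (2 * Real.logb 2 n)) /
        ((n : ℝ) ^ (0.98 : ℝ) * (n : ℝ) ^ (0.02 : ℝ)) := by rw [← hnn]
    _ = ((2 * Real.logb 2 n) * (2 * Real.logb 2 n)) / (n : ℝ) ^ (0.02 : ℝ) :=
        mul_div_mul_left _ _ (by positivity)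
    _ = _ := by
        rw [Real.logb, Real.rpow_two]
        have : Real.log 2 ≠ 0 := (Real.log_pos (by norm_num)).ne'
        field_simp
        ring

lemma choose_two_ratio {k m : ℕ} (hk : 400 ≤ k) (hm : (0.98 : ℝ) * k - 1 ≤ m) :
    (0.951 : ℝ) ≤ (m.choose 2 : ℝ) / k.choose 2 := by
  have hk' : (400 : ℝ) ≤ k := by exact_mod_cast hk
  rw [Nat.cast_choose_two, Nat.cast_choose_two, le_div_iff₀ (by nlinarith)]
  nlinarith

lemma log_le_self_eventually : ∀ᶠ n : ℕ in atTop, ⌊2 * Real.logb 2 n⌋₊ ≤ n := by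
  have h := ((Real.isLittleO_logb_id_atTop (b := 2)).bound (c := 1 / 2) (by norm_num))
  filter_upwards [(tendsto_natCast_atTop_atTop (R := ℝ)).eventually h] with n hn
  refine Nat.floor_le_of_le ?_
  simp only [id, Real.norm_eq_abs, Nat.abs_cast] at hn
  linarith [le_abs_self (Real.logb 2 (n : ℝ))]

lemma k_large_eventually : ∀ᶠ n : ℕ in atTop, 400 ≤ ⌊2 * Real.logb 2 n⌋₊ := by
  have h : Tendsto (fun n : ℕ => 2 * Real.logb 2 n) atTop atTop :=
    ((Real.tendsto_logb_atTop (b := 2) (by norm_num)).comp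
      (tendsto_natCast_atTop_atTop (R := ℝ))).const_mul_atTop (by norm_num)
  exact (tendsto_nat_floor_atTop.comp h).eventually (eventually_ge_atTop 400)

/-- For every ε > 0, the probability that `G(n, 1/2)` contains a vertex subset `S` with
`|S| = ⌊2 log₂ n⌋` whose induced subgraph has edge density at least `0.951 - ε`
tends to 1 as `n → ∞`. -/
theorem stmt0 (ε : ℝ) (hε : 0 < ε) :
    Tendsto (fun n : ℕ =>
        gnHalf n {g | ∃ S : Finset (Fin n),
          S.card = ⌊2 * Real.logb 2 n⌋₊ ∧ 0.951 - ε ≤ density n g S})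
      atTop (nhds 1) := by
  have hprob : ∀ n, IsProbabilityMeasure (gnHalf n) := fun n => by
    unfold gnHalf; infer_instance
  have hlow : Tendsto (fun n : ℕ => ENNReal.ofReal (1 -
    √2 ^ ⌊(0.98 : ℝ) * (⌊2 * Real.logb 2 n⌋₊ : ℝ)⌋₊ *
      (⌊(0.98 : ℝ) * (⌊2 * Real.logb 2 n⌋₊ : ℝ)⌋₊ : ℝ) / n
      * (⌊(0.98 : ℝ) * (⌊2 * Real.logb 2 n⌋₊ : ℝ)⌋₊ : ℝ))) atTop (nhds 1) := by
    have := ENNReal.tendsto_ofReal (err_tendsto.const_sub 1)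
    simpa using this
  refine tendsto_of_tendsto_of_tendsto_of_le_of_le' hlow tendsto_const_nhds ?_
    (Eventually.of_forall fun n => prob_le_one)
  filter_upwards [log_le_self_eventually, k_large_eventually] with n h1 h2
  refine gnHalf_lower ?_ h1 (by omega) _ ?_
  · refine Nat.floor_le_of_le ?_
    have : (0 : ℝ) ≤ (⌊2 * Real.logb 2 n⌋₊ : ℝ) := by positivity
    linarith
  · refine le_trans (by linarith) (choose_two_ratio h2 ?_)
    exact (Nat.sub_one_lt_floor _).le
end

section
/- Fix ε > 0. Let n be sufficiently large, set k = ⌊2 log₂ n⌋, and consider the Erdős–Rényi random graph G(n, 1/2). Fix two disjoint vertex subsets T of size i ≥ 1 and V' of size ⌊n/k⌋. If δ ∈ [0, 1/2] satisfies H(δ) ≥ 1 − (1/i)·log₂( n / (2k·ln(log₂ n)) ) + ε, then with probability at least 1 − 1/(log₂ n)², there exists a vertex v ∈ V' that has at least (1 − δ)·i edges to T. -/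
open MeasureTheory Filter

open scoped Classical in
/-- Number of edges of the graph `g` joining the vertex `v` to vertices of `T`. -/
noncomputable def vertEdgeCount (n : ℕ) (g : Sym2 (Fin n) → Bool) (v : Fin n)
    (T : Finset (Fin n)) : ℕ :=
  (T.filter fun u => u ≠ v ∧ g s(v, u) = true).card

lemma count_aux {E V W : Type} [Finite E] [Finite V] [Finite W] (ι : V × W → E)
    (hι : Function.Injective ι) :
    ∃ R : ℕ, ∀ B : Set (W → Bool),
      Nat.card {g : E → Bool // ∀ v, (fun u => g (ι (v, u))) ∈ B} = Nat.card B ^ Nat.card V * R := by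
  classical
  refine ⟨Nat.card ({e : E // e ∉ Set.range ι} → Bool), fun B => ?_⟩
  let e1 : (E → Bool) ≃ (V → W → Bool) × ({e : E // e ∉ Set.range ι} → Bool) :=
    (Equiv.piEquivPiSubtypeProd (fun e => e ∈ Set.range ι) (fun _ => Bool)).trans
      (Equiv.prodCongr (((Equiv.ofInjective ι hι).symm.arrowCongr (Equiv.refl Bool)).trans
        (Equiv.curry V W Bool)) (Equiv.refl _))
  have h1 : {g : E → Bool // ∀ v, (fun u => g (ι (v, u))) ∈ B} ≃
      {x : (V → W → Bool) × ({e : E // e ∉ Set.range ι} → Bool) // (∀ v, x.1 v ∈ B) ∧ True} :=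
    e1.subtypeEquiv (fun g => by
      simp only [and_true]
      rfl)
  have h2 := h1.trans (Equiv.subtypeProdEquivProd (p := fun f : V → W → Bool => ∀ v, f v ∈ B)
    (q := fun _ : ({e : E // e ∉ Set.range ι} → Bool) => True))
  rw [Nat.card_congr h2, Nat.card_prod,
    Nat.card_congr (Equiv.subtypePiEquivPi (p := fun (_ : V) (b : W → Bool) => b ∈ B)),
    Nat.card_congr (Equiv.subtypeUnivEquiv (fun _ => trivial)), Nat.card_fun]

open scoped Classical in
lemma bad_aux {W : Type} [Fintype W] (δ : ℝ) (a : ℕ) (ha : (a : ℝ) ≤ δ * Fintype.card W)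
    (ha' : a ≤ Fintype.card W) :
    Nat.card {b : W → Bool | ¬ ((1 - δ) * (Fintype.card W : ℝ) ≤
        ((Finset.univ.filter fun u => b u = true).card : ℝ))} + (Fintype.card W).choose a
      ≤ 2 ^ Fintype.card W := by
  set P : (W → Bool) → Prop := fun b => (1 - δ) * (Fintype.card W : ℝ) ≤
        ((Finset.univ.filter fun u => b u = true).card : ℝ) with hP
  have h1 : (Finset.univ.filter fun b => P b).card + (Finset.univ.filter fun b => ¬ P b).card
      = 2 ^ Fintype.card W := by
    rw [Finset.card_filter_add_card_filter_not]; simp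
  have h2 : Nat.card {b : W → Bool | ¬ P b} = (Finset.univ.filter fun b => ¬ P b).card := by
    rw [Nat.card_eq_fintype_card, ← Fintype.card_subtype]; rfl
  have h3 : (Fintype.card W).choose a ≤ (Finset.univ.filter fun b => P b).card := by
    have h4 : (Fintype.card W).choose a = (Finset.powersetCard a (Finset.univ : Finset W)).card := by
      rw [Finset.card_powersetCard, Finset.card_univ]
    rw [h4]
    apply Finset.card_le_card_of_injOn (fun s u => decide (u ∉ s))
    · intro s hs
      have hs' := (Finset.mem_powersetCard.1 (Finset.mem_coe.1 hs)).2
      have : (Finset.univ.filter fun u => u ∉ s) = sᶜ := by ext; simp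
      simp only [hP, Finset.coe_filter, Finset.mem_univ, true_and, Set.mem_ofPred_eq, decide_eq_true_eq, this]
      rw [Finset.card_compl, hs', Nat.cast_sub ha']
      linarith
    · intro s _ t _ h
      ext u
      have := congrFun h u
      simpa [not_iff_not] using this
  change Nat.card {b : W → Bool | ¬ P b} + _ ≤ _
  omega

lemma mode_aux (i a j : ℕ) (ha : a ≤ i) (hj : j ≤ i) :
    a ^ j * (i - a) ^ (i - j) * i.choose j ≤ i.choose a * a ^ a * (i - a) ^ (i - a) := by
  obtain ⟨b, rfl⟩ := Nat.exists_eq_add_of_le ha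
  obtain ⟨c, hc⟩ := Nat.exists_eq_add_of_le hj
  have e1 : a + b - a = b := by omega
  have e2 : a + b - j = c := by omega
  rw [e1, e2]
  have f1 : (a + b).choose a * a.factorial * b.factorial = (a+b).factorial :=
    by rw [Nat.choose_symm_add]; exact Nat.add_choose_mul_factorial_mul_factorial a b
  have f2 : (a + b).choose j * j.factorial * c.factorial = (a+b).factorial := by
    rw [hc, Nat.choose_symm_add]; exact Nat.add_choose_mul_factorial_mul_factorial j c
  have key : a.factorial * b.factorial * (a ^ j * b ^ c) ≤ j.factorial * c.factorial * (a ^ a * b ^ b) := by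
    have gen : ∀ x y : ℕ, x.factorial * x ^ y ≤ y.factorial * x ^ x := by
      intro x y
      rcases le_total x y with h | h
      · obtain ⟨d, rfl⟩ := Nat.exists_eq_add_of_le h
        have := Nat.factorial_mul_pow_le_factorial (m := x) (n := d)
        have h3 : x.factorial * x ^ d ≤ (x + d).factorial :=
          le_trans (Nat.mul_le_mul_left _ (Nat.pow_le_pow_left (by omega) _)) this
        calc x.factorial * x ^ (x + d) = (x.factorial * x ^ d) * x ^ x := by ring
          _ ≤ _ := Nat.mul_le_mul_right _ h3
      · obtain ⟨d, rfl⟩ := Nat.exists_eq_add_of_le h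
        have h3 : (y + d).factorial ≤ y.factorial * (y + d) ^ d := by
          have := Nat.factorial_mul_descFactorial (n := y + d) (k := d) (by omega)
          rw [← this]
          simp only [Nat.add_sub_cancel]
          exact Nat.mul_le_mul_left _ (Nat.descFactorial_le_pow _ _)
        calc (y + d).factorial * (y + d) ^ y ≤ (y.factorial * (y + d) ^ d) * (y + d) ^ y :=
              Nat.mul_le_mul_right _ h3
          _ = _ := by rw [pow_add (y + d) y d]; ring
    calc _ = (a.factorial * a ^ j) * (b.factorial * b ^ c) := by ring
      _ ≤ (j.factorial * a ^ a) * (c.factorial * b ^ b) := Nat.mul_le_mul (gen a j) (gen b c)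
      _ = _ := by ring
  have pos : 0 < a.factorial * b.factorial * (j.factorial * c.factorial) := by positivity
  refine Nat.le_of_mul_le_mul_left ?_ pos
  calc _ = ((a + b).choose j * j.factorial * c.factorial) * (a.factorial * b.factorial * (a ^ j * b ^ c)) := by ring
    _ ≤ ((a + b).choose j * j.factorial * c.factorial) * (j.factorial * c.factorial * (a ^ a * b ^ b)) :=
      Nat.mul_le_mul_left _ key
    _ = ((a + b).choose a * a.factorial * b.factorial) * (j.factorial * c.factorial * (a ^ a * b ^ b)) := by rw [f1, f2]
    _ = _ := by ring

lemma choose_aux (i a : ℕ) (ha : a ≤ i) :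
    i ^ i ≤ (i + 1) * (i.choose a * a ^ a * (i - a) ^ (i - a)) := by
  have h := add_pow a (i - a) i
  rw [Nat.add_sub_cancel' ha] at h
  calc i ^ i = _ := h
    _ ≤ ∑ _m ∈ Finset.range (i + 1), (i.choose a * a ^ a * (i - a) ^ (i - a)) := by
      apply Finset.sum_le_sum
      intro j hj
      exact mode_aux i a j ha (by simp at hj; omega)
    _ = _ := by simp

lemma binEnt_eq (x : ℝ) : binEnt x = Real.binEntropy x / Real.log 2 := by
  rw [binEnt, Real.binEntropy_eq_negMulLog_add_negMulLog_one_sub, Real.negMulLog, Real.negMulLog,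
    Real.logb, Real.logb]
  ring

lemma choose_ent (i a : ℕ) (hi : 1 ≤ i) (ha : a ≤ i) :
    Real.exp (i * Real.binEntropy (a / i)) ≤ (i + 1) * (i.choose a : ℝ) := by
  have h : (i : ℝ) ^ i ≤ (i + 1) * (i.choose a * a ^ a * ((i - a : ℕ) : ℝ) ^ (i - a)) := by
    exact_mod_cast choose_aux i a ha
  obtain ⟨b, rfl⟩ := Nat.exists_eq_add_of_le ha
  rw [Nat.add_sub_cancel_left] at h
  have hpp : ∀ m : ℕ, (0:ℝ) < (m : ℝ) ^ m := by
    intro m; rcases Nat.eq_zero_or_pos m with rfl | h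
    · simp
    · positivity
  have hpow : ∀ m : ℕ, (m : ℝ) ^ m = Real.exp (m * Real.log m) := by
    intro m; rcases Nat.eq_zero_or_pos m with rfl | h
    · simp
    · rw [mul_comm, Real.exp_mul, Real.exp_log (by positivity), Real.rpow_natCast]
  have hab : (0:ℝ) < ((a + b : ℕ) : ℝ) := by exact_mod_cast hi
  have hent : ((a + b : ℕ) : ℝ) * Real.binEntropy (a / (a + b : ℕ)) =
      ((a + b : ℕ) : ℝ) * Real.log (a + b : ℕ) - a * Real.log a - b * Real.log b := by
    have e : (1 : ℝ) - a / (a + b : ℕ) = b / (a + b : ℕ) := by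
      field_simp; push_cast; ring
    have hl : ∀ m : ℕ, (m : ℝ) * Real.log (m / (a + b : ℕ)) =
        m * Real.log m - m * Real.log (a + b : ℕ) := by
      intro m; rcases Nat.eq_zero_or_pos m with rfl | h
      · simp
      · rw [Real.log_div (by positivity) hab.ne']; ring
    rw [Real.binEntropy_eq_negMulLog_add_negMulLog_one_sub, e, Real.negMulLog, Real.negMulLog]
    have : ((a + b : ℕ) : ℝ) * (-(a / (a + b : ℕ)) * Real.log (a / (a + b : ℕ)) + -(b / (a + b : ℕ)) * Real.log (b / (a + b : ℕ)))
       = -((a : ℝ) * Real.log (a / (a + b : ℕ))) - (b : ℝ) * Real.log (b / (a + b : ℕ)) := by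
      field_simp
      ring
    rw [this, hl, hl]; push_cast; ring
  rw [hent, Real.exp_sub, Real.exp_sub, ← hpow, ← hpow, ← hpow, div_div, div_le_iff₀ (mul_pos (hpp a) (hpp b))]
  calc _ ≤ _ := h
    _ = _ := by ring

open scoped Classical in
lemma prob_aux (n : ℕ) (T V' : Finset (Fin n)) (δ : ℝ) (a : ℕ) (c : ℝ)
    (hd : Disjoint T V') (ha : (a : ℝ) ≤ δ * T.card) (ha' : a ≤ T.card) (hc : 0 ≤ c)
    (h : Real.exp (-((T.card.choose a : ℝ) / 2 ^ T.card * V'.card)) ≤ c) :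
    ENNReal.ofReal (1 - c) ≤
      gnHalf n {g | ∃ v ∈ V', (1 - δ) * (T.card : ℝ) ≤ (vertEdgeCount n g v T : ℝ)} := by
  set S : Set (Sym2 (Fin n) → Bool) :=
    {g | ∃ v ∈ V', (1 - δ) * (T.card : ℝ) ≤ (vertEdgeCount n g v T : ℝ)} with hS
  let ι : V' × T → Sym2 (Fin n) := fun x => s((x.1 : Fin n), (x.2 : Fin n))
  have hι : Function.Injective ι := by
    rintro ⟨⟨v, hv⟩, ⟨u, hu⟩⟩ ⟨⟨v', hv'⟩, ⟨u', hu'⟩⟩ h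
    simp only [ι, Sym2.eq_iff] at h
    rcases h with ⟨rfl, rfl⟩ | ⟨rfl, rfl⟩
    · rfl
    · exact absurd hv (Finset.disjoint_left.1 hd hu')
  obtain ⟨R, hR⟩ := count_aux ι hι
  have hb := bad_aux (W := T) δ a (by simpa using ha) (by simpa using ha')
  set B : Set (T → Bool) := {b : T → Bool | ¬ ((1 - δ) * (Fintype.card T : ℝ) ≤
        ((Finset.univ.filter fun u => b u = true).card : ℝ))} with hB
  have hcount : ∀ (g : Sym2 (Fin n) → Bool) (v : V'), vertEdgeCount n g v T =
      (Finset.univ.filter fun u : T => g (ι (v, u)) = true).card := by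
    intro g v
    rw [vertEdgeCount]
    symm
    apply Finset.card_bij (fun (u : T) _ => (u : Fin n))
    · intro u hu
      simp only [Finset.mem_filter, Finset.mem_univ, true_and] at hu
      refine Finset.mem_filter.2 ⟨u.2, ?_, hu⟩
      intro h
      exact Finset.disjoint_left.1 hd u.2 (h ▸ v.2)
    · intro u _ w _ h
      exact Subtype.ext h
    · intro u hu
      have hu := Finset.mem_filter.1 hu
      exact ⟨⟨u, hu.1⟩, by simpa [ι] using hu.2.2, rfl⟩
  have hSc : Sᶜ = {g | ∀ v : V', (fun u => g (ι (v, u))) ∈ B} := by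
    ext g
    simp only [hS, hB, Set.mem_compl_iff, Set.mem_ofPred_eq, not_exists, not_and, Fintype.card_coe]
    constructor
    · intro h v
      rw [← hcount]
      exact h v v.2
    · intro h v hv
      have := h ⟨v, hv⟩
      rw [← hcount] at this
      exact this
  have hcard1 : Nat.card (Sᶜ : Set _) = Nat.card B ^ V'.card * R := by
    rw [hSc]
    have := hR B
    rw [Nat.card_eq_fintype_card (α := V'), Fintype.card_coe] at this
    exact this
  have hcard2 : Nat.card (Sym2 (Fin n) → Bool) = (2 ^ T.card) ^ V'.card * R := by
    have := hR Set.univ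
    rw [Nat.card_congr (Equiv.subtypeUnivEquiv (fun _ _ => Set.mem_univ _)), Nat.card_univ,
      Nat.card_fun, Nat.card_fun, Nat.card_eq_fintype_card (α := V'), Fintype.card_coe,
      Nat.card_eq_fintype_card (α := T), Fintype.card_coe, Nat.card_eq_fintype_card (α := Bool),
      Fintype.card_bool] at this
    rw [Nat.card_fun, Nat.card_eq_fintype_card (α := Bool), Fintype.card_bool]
    exact this
  have hRpos : 0 < R := by
    rcases Nat.eq_zero_or_pos R with h0 | h0
    · rw [h0, mul_zero] at hcard2
      exact absurd hcard2 Nat.card_pos.ne'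
    · exact h0
  have hreal : (Nat.card (Sᶜ : Set _) : ℝ) ≤ c * (Nat.card (Sym2 (Fin n) → Bool) : ℝ) := by
    rw [hcard1, hcard2]
    push_cast
    rw [← mul_assoc]
    refine mul_le_mul_of_nonneg_right ?_ (by positivity)
    have h2 : (0:ℝ) < 2 ^ T.card := by positivity
    have hb' : (Nat.card B : ℝ) + (T.card.choose a : ℝ) ≤ 2 ^ T.card := by
      rw [Fintype.card_coe] at hb
      exact_mod_cast hb
    have h3 : (Nat.card B : ℝ) ≤ 2 ^ T.card * Real.exp (-((T.card.choose a : ℝ) / 2 ^ T.card)) := by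
      have := Real.add_one_le_exp (-((T.card.choose a : ℝ) / 2 ^ T.card))
      calc (Nat.card B : ℝ) ≤ 2 ^ T.card * (-((T.card.choose a : ℝ) / 2 ^ T.card) + 1) := by
            field_simp
            linarith
        _ ≤ _ := by gcongr
    calc (Nat.card B : ℝ) ^ V'.card ≤
          (2 ^ T.card * Real.exp (-((T.card.choose a : ℝ) / 2 ^ T.card))) ^ V'.card := by gcongr
      _ = Real.exp (-((T.card.choose a : ℝ) / 2 ^ T.card * V'.card)) * (2 ^ T.card) ^ V'.card := by
          rw [mul_pow, ← Real.exp_nat_mul, mul_comm]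
          congr 2
          ring
      _ ≤ _ := by gcongr
  have hmeas : MeasurableSet S := MeasurableSet.of_discrete
  have : IsProbabilityMeasure (gnHalf n) := by unfold gnHalf; infer_instance
  have hcompl : gnHalf n Sᶜ ≤ ENNReal.ofReal c := by
    rw [gnHalf, PMF.toMeasure_uniformOfFintype_apply _ hmeas.compl]
    apply ENNReal.div_le_of_le_mul
    rw [← Nat.card_eq_fintype_card, ← Nat.card_eq_fintype_card, ← ENNReal.ofReal_natCast,
      ← ENNReal.ofReal_natCast, ← ENNReal.ofReal_mul hc]
    exact ENNReal.ofReal_le_ofReal hreal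
  have h1 : gnHalf n S = 1 - gnHalf n Sᶜ := by
    rw [← prob_compl_eq_one_sub hmeas.compl, compl_compl]
  rw [h1, ENNReal.ofReal_sub _ hc, ENNReal.ofReal_one]
  exact tsub_le_tsub_left hcompl _

lemma ent_unif (c : ℝ) (hc : 0 < c) : ∃ I : ℕ, 1 ≤ I ∧ ∀ i : ℕ, I ≤ i →
    2 * ((i : ℝ) + 1) ≤ Real.exp (c * i) ∧
    ∀ δ ∈ Set.Icc (0 : ℝ) (1/2), Real.binEntropy δ - c ≤ Real.binEntropy ((⌊δ * i⌋₊ : ℝ) / i) := by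
  have hu : UniformContinuousOn Real.binEntropy (Set.Icc (0:ℝ) (1/2)) :=
    isCompact_Icc.uniformContinuousOn_of_continuous Real.binEntropy_continuous.continuousOn
  obtain ⟨η, hη, hu⟩ := Metric.uniformContinuousOn_iff.1 hu c hc
  obtain ⟨I1, hI1⟩ := exists_nat_gt (1 / η)
  obtain ⟨I2, hI2⟩ := exists_nat_gt (8 / c ^ 2)
  refine ⟨I1 + I2 + 1, by omega, fun i hi => ?_⟩
  have hi' : (I1 : ℝ) + I2 + 1 ≤ i := by exact_mod_cast hi
  have p1 : (0:ℝ) ≤ I1 := by positivity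
  have p2 : (0:ℝ) ≤ I2 := by positivity
  have hipos : (0:ℝ) < i := by linarith
  constructor
  · have q := Real.quadratic_le_exp_of_nonneg (x := c * i) (by positivity)
    have h8 : 8 ≤ c ^ 2 * i := by
      have : 8 / c ^ 2 ≤ i := by linarith
      rw [div_le_iff₀ (by positivity)] at this
      linarith
    have : 8 * (i:ℝ) ≤ (c * i) ^ 2 := by nlinarith
    have : 0 < c * i := by positivity
    nlinarith
  · intro δ hδ
    have f1 : (⌊δ * i⌋₊ : ℝ) ≤ δ * i := Nat.floor_le (mul_nonneg hδ.1 hipos.le)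
    have f2 : δ * i < ⌊δ * i⌋₊ + 1 := Nat.lt_floor_add_one _
    have g1 : (⌊δ * i⌋₊ : ℝ) / i ≤ δ := by rw [div_le_iff₀ hipos]; exact f1
    have g2 : δ - η < (⌊δ * i⌋₊ : ℝ) / i := by
      rw [lt_div_iff₀ hipos]
      have : 1 < η * i := by
        have : 1 / η < i := by linarith
        rw [div_lt_iff₀ hη] at this
        linarith
      linarith
    have := hu δ hδ ((⌊δ * i⌋₊ : ℝ) / i) ⟨by positivity, g1.trans hδ.2⟩
      (by rw [Real.dist_eq, abs_lt]; constructor <;> linarith)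
    rw [Real.dist_eq, abs_lt] at this
    linarith

lemma n_large (C : ℝ) : ∃ N : ℕ, ∀ n : ℕ, N ≤ n →
    3 ≤ Real.logb 2 n ∧ C * (Real.logb 2 n) ^ 2 ≤ n := by
  have h1 : Tendsto (fun n : ℕ => Real.logb 2 (n : ℝ)) atTop atTop :=
    (Real.tendsto_logb_atTop one_lt_two).comp tendsto_natCast_atTop_atTop
  have h2 : (fun x : ℝ => Real.log x ^ 2) =o[atTop] (id : ℝ → ℝ) := Real.isLittleO_pow_log_id_atTop
  have hl : 0 < Real.log 2 := Real.log_pos one_lt_two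
  have h3 := (h2.def (c := Real.log 2 ^ 2 / (|C| + 1)) (by positivity))
  have h4 := tendsto_natCast_atTop_atTop.eventually h3
  obtain ⟨N, hN⟩ := eventually_atTop.1 ((h1.eventually_ge_atTop 3).and h4)
  refine ⟨N, fun n hn => ⟨(hN n hn).1, ?_⟩⟩
  have h := (hN n hn).2
  simp only [Real.norm_eq_abs, abs_pow, sq_abs, id, Nat.abs_cast] at h
  rw [Real.logb, div_pow]
  rw [div_mul_eq_mul_div, le_div_iff₀ (by positivity)] at h
  rw [mul_div_assoc', div_le_iff₀ (by positivity)]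
  have := le_abs_self C
  have : 0 ≤ Real.log (n:ℝ) ^ 2 := by positivity
  nlinarith

/-- Fix ε > 0. For sufficiently large n, set `k = ⌊2 log₂ n⌋` and fix two disjoint vertex
subsets `T` of size `i ≥ 1` and `V'` of size `⌊n/k⌋`. If δ ∈ [0, 1/2] satisfies
`H(δ) ≥ 1 − (1/i)·log₂(n / (2k·ln(log₂ n))) + ε`, then with probability at least
`1 − 1/(log₂ n)²` there exists `v ∈ V'` having at least `(1 − δ)·i` edges to `T`. -/
theorem stmt3 (ε : ℝ) (hε : 0 < ε) :
    ∃ N : ℕ, ∀ n : ℕ, N ≤ n →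
      ∀ (T V' : Finset (Fin n)) (i : ℕ) (δ : ℝ),
        Disjoint T V' → 1 ≤ i → T.card = i →
        V'.card = n / ⌊2 * Real.logb 2 n⌋₊ →
        δ ∈ Set.Icc (0 : ℝ) (1/2) →
        1 - (1 / (i : ℝ)) *
            Real.logb 2 ((n : ℝ) /
              (2 * (⌊2 * Real.logb 2 n⌋₊ : ℝ) * Real.log (Real.logb 2 n))) + ε ≤ binEnt δ →
        ENNReal.ofReal (1 - 1 / (Real.logb 2 n) ^ 2) ≤
          gnHalf n {g | ∃ v ∈ V', (1 - δ) * (i : ℝ) ≤ (vertEdgeCount n g v T : ℝ)} := by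
  have hl2 : 0 < Real.log 2 := Real.log_pos one_lt_two
  obtain ⟨I, hI1, hI⟩ := ent_unif (ε * Real.log 2 / 2) (by positivity)
  obtain ⟨N, hN⟩ := n_large (2 ^ I * 8)
  refine ⟨N, fun n hn T V' i δ hd hi hT hV hδ hH => ?_⟩
  obtain ⟨hL, hn2⟩ := hN n hn
  set L := Real.logb 2 (n : ℝ) with hLdef
  set k := ⌊2 * L⌋₊ with hk
  have hlogL : 0 < Real.log L := Real.log_pos (by linarith)
  have hk1 : (k : ℝ) ≤ 2 * L := Nat.floor_le (by linarith)
  have hk0 : 0 < k := Nat.floor_pos.2 (by linarith)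
  have hk0' : (0:ℝ) < k := by exact_mod_cast hk0
  have h2I : (1:ℝ) ≤ 2 ^ I := one_le_pow₀ (by norm_num)
  have hn8 : 8 * L ^ 2 ≤ n := by nlinarith [sq_nonneg L]
  have hn0 : (0:ℝ) < n := by nlinarith
  have hkn : 2 * (k : ℝ) ≤ n := by nlinarith
  have hmk : (n : ℝ) ≤ 2 * ((V'.card : ℝ) * k) := by
    have h1 : n < (n / k) * k + k := by
      have := Nat.div_add_mod n k
      have := Nat.mod_lt n hk0
      nlinarith
    have h2 : (n : ℝ) < (V'.card : ℝ) * k + k := by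
      rw [hV]; exact_mod_cast h1
    linarith
  have hV0 : (0:ℝ) ≤ V'.card := by positivity
  subst hT
  have hi0 : (0:ℝ) < T.card := by exact_mod_cast hi
  have main : ∀ a : ℕ, (a : ℝ) ≤ δ * T.card → a ≤ T.card →
      2 * Real.log L ≤ (T.card.choose a : ℝ) / 2 ^ T.card * V'.card →
      ENNReal.ofReal (1 - 1 / L ^ 2) ≤
        gnHalf n {g | ∃ v ∈ V', (1 - δ) * (T.card : ℝ) ≤ (vertEdgeCount n g v T : ℝ)} := by
    intro a ha ha' h
    refine prob_aux n T V' δ a _ hd ha ha' (by positivity) ?_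
    have e : (1 / L ^ 2 : ℝ) = Real.exp (-(2 * Real.log L)) := by
      rw [Real.exp_neg, two_mul, Real.exp_add, Real.exp_log (by linarith), one_div, sq]
    rw [e]
    exact Real.exp_le_exp.2 (by linarith)
  rcases lt_or_ge T.card I with hlt | hge
  · refine main 0 (by simpa using mul_nonneg hδ.1 hi0.le) (Nat.zero_le _) ?_
    rw [Nat.choose_zero_right, Nat.cast_one, div_mul_eq_mul_div, one_mul, le_div_iff₀ (by positivity)]
    have h1 : (2:ℝ) ^ T.card ≤ 2 ^ I := pow_le_pow_right₀ (by norm_num) hlt.le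
    have h2 : Real.log L ≤ L := (Real.log_le_sub_one_of_pos (by linarith)).trans (by linarith)
    have h3 : 2 * Real.log L * 2 ^ T.card ≤ 2 * L * 2 ^ I := by gcongr
    have h4 : 2 ^ I * 8 * L ^ 2 ≤ 4 * L * (V'.card : ℝ) := by
      have : (V'.card : ℝ) * k ≤ V'.card * (2 * L) := by gcongr
      linarith
    have h5 : 2 * L * 2 ^ I ≤ (V'.card : ℝ) := by
      have hL0 : 0 < 4 * L := by linarith
      refine le_of_mul_le_mul_left ?_ hL0
      linarith
    linarith
  · obtain ⟨hexp, hent⟩ := hI T.card hge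
    have hent := hent δ hδ
    have hfl : (⌊δ * T.card⌋₊ : ℝ) ≤ δ * T.card := Nat.floor_le (mul_nonneg hδ.1 hi0.le)
    have hfl' : ⌊δ * T.card⌋₊ ≤ T.card := by
      have : (⌊δ * T.card⌋₊ : ℝ) ≤ T.card := by nlinarith [hδ.2]
      exact_mod_cast this
    refine main _ hfl hfl' ?_
    have hch := choose_ent T.card _ hi hfl'
    set a := ⌊δ * T.card⌋₊ with ha
    set X : ℝ := (n : ℝ) / (2 * (k : ℝ) * Real.log L) with hX
    have hX0 : 0 < X := by positivity
    rw [binEnt_eq, Real.logb, le_div_iff₀ hl2] at hH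
    have hH' : T.card * Real.log 2 - Real.log X + T.card * (ε * Real.log 2) ≤
        T.card * Real.binEntropy δ := by
      have := mul_le_mul_of_nonneg_left hH hi0.le
      have e : (T.card : ℝ) * ((1 - 1 / (T.card : ℝ) * (Real.log X / Real.log 2) + ε) * Real.log 2) =
        T.card * Real.log 2 - Real.log X + T.card * (ε * Real.log 2) := by
        generalize Real.log X = lX
        field_simp
      linarith
    have hE : T.card * Real.log 2 - Real.log X + ε * Real.log 2 / 2 * T.card ≤
        T.card * Real.binEntropy ((a : ℝ) / T.card) := by
      have := mul_le_mul_of_nonneg_left hent hi0.le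
      linarith
    have hE2 : 2 ^ T.card / X * (2 * ((T.card : ℝ) + 1)) ≤ (T.card + 1) * (T.card.choose a : ℝ) := by
      refine le_trans ?_ ((Real.exp_le_exp.2 hE).trans hch)
      rw [Real.exp_add, Real.exp_sub, Real.exp_log hX0, Real.exp_nat_mul, Real.exp_log two_pos]
      gcongr
    have hE3 : 2 / X ≤ (T.card.choose a : ℝ) / 2 ^ T.card := by
      have h1 : (0:ℝ) < (T.card : ℝ) + 1 := by linarith
      rw [le_div_iff₀ (by positivity)]
      refine le_of_mul_le_mul_left ?_ h1
      calc _ = 2 ^ T.card / X * (2 * ((T.card : ℝ) + 1)) := by ring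
        _ ≤ _ := hE2
    calc 2 * Real.log L ≤ 2 / X * V'.card := by
          rw [hX]
          have : 2 / ((n : ℝ) / (2 * (k : ℝ) * Real.log L)) * V'.card =
            (4 * (V'.card * k) * Real.log L) / n := by
            field_simp
            ring
          rw [this, le_div_iff₀ hn0]
          nlinarith
      _ ≤ _ := by gcongr
end
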